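/- Groenewold–Van Hove no-go theorem for the sphere: every admissible quantization of (P, P¹) is trivial. That is, if Q is an ℝ-linear map from P to the endomorphisms of a nonzero finite-dimensional complex inner product space V such that every Q(f) is self-adjoint, Q({f,g}) = −i[Q(f),Q(g)] for all f,g ∈ P, Q(1) = I, and the only subspaces of V invariant under all of Q(S₁), Q(S₂), Q(S₃) are {0} and V, then Q(S₁) = Q(S₂) = Q(S₃) = 0 (and hence V is one-dimensional). -/

import Mathlib

open MvPolynomial MeasureTheory

noncomputable section

attribute [local instance] Classical.propDecidable

/-- The Poisson bracket on `ℝ[X₀,X₁,X₂]` associated to the sphere: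
`{f,g} = Σ εᵢⱼₖ Xᵢ ∂f/∂Xⱼ ∂g/∂Xₖ` (indices `0,1,2` play the role of `1,2,3`). -/
def pb (f g : MvPolynomial (Fin 3) ℝ) : MvPolynomial (Fin 3) ℝ :=
  X 0 * (pderiv 1 f * pderiv 2 g - pderiv 2 f * pderiv 1 g) +
  X 1 * (pderiv 2 f * pderiv 0 g - pderiv 0 f * pderiv 2 g) +
  X 2 * (pderiv 0 f * pderiv 1 g - pderiv 1 f * pderiv 0 g)

/-- The ideal generated by `X₀² + X₁² + X₂² - s²`. -/
def sphereIdeal (s : ℝ) : Ideal (MvPolynomial (Fin 3) ℝ) :=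
  Ideal.span {X 0 ^ 2 + X 1 ^ 2 + X 2 ^ 2 - C (s ^ 2)}

/-- The Poisson algebra `P` of polynomial functions on the sphere of radius `s`. -/
abbrev SpherePoly (s : ℝ) := MvPolynomial (Fin 3) ℝ ⧸ sphereIdeal s

/-- The quotient map `ℝ[X₀,X₁,X₂] → P`. -/
def toSphere (s : ℝ) : MvPolynomial (Fin 3) ℝ →+* SpherePoly s :=
  Ideal.Quotient.mk (sphereIdeal s)

/-- The components `S₁, S₂, S₃` of the spin vector (indexed by `Fin 3`). -/
def S (s : ℝ) (i : Fin 3) : SpherePoly s := toSphere s (X i)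

/-- A choice of polynomial representative of an element of `P`. -/
def rep (s : ℝ) (p : SpherePoly s) : MvPolynomial (Fin 3) ℝ :=
  (Ideal.Quotient.mk_surjective (I := sphereIdeal s) p).choose

/-- The Poisson bracket descended to `P`.  (It is independent of the choice of
representatives, since the bracket of any polynomial with the generator
`X₀² + X₁² + X₂² - s²` vanishes identically.) -/
def pbS (s : ℝ) (p q : SpherePoly s) : SpherePoly s :=
  toSphere s (pb (rep s p) (rep s q))

/-- The sphere relation is a Casimir of `pb`, so `pb` descends to the quotient. -/
lemma toSphere_pb_congr (s : ℝ) {f f' g g' : MvPolynomial (Fin 3) ℝ}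
    (hf : toSphere s f = toSphere s f') (hg : toSphere s g = toSphere s g') :
    toSphere s (pb f g) = toSphere s (pb f' g') := by
  have h0 : toSphere s (X 0 ^ 2 + X 1 ^ 2 + X 2 ^ 2 - C (s ^ 2)) = 0 :=
    Ideal.Quotient.eq_zero_iff_mem.2 (Ideal.subset_span rfl)
  obtain ⟨a, ha⟩ := Ideal.mem_span_singleton.1 (Ideal.Quotient.eq.1 hf)
  obtain ⟨b, hb⟩ := Ideal.mem_span_singleton.1 (Ideal.Quotient.eq.1 hg)
  obtain rfl := sub_eq_iff_eq_add.1 ha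
  obtain rfl := sub_eq_iff_eq_add.1 hb
  set c : MvPolynomial (Fin 3) ℝ := X 0 ^ 2 + X 1 ^ 2 + X 2 ^ 2 - C (s ^ 2) with hc
  have d0 : pderiv 0 c = 2 * X 0 := by simp [hc, pderiv_X]
  have d1 : pderiv 1 c = 2 * X 1 := by simp [hc, pderiv_X]
  have d2 : pderiv 2 c = 2 * X 2 := by simp [hc, pderiv_X]
  have key : pb (c * a + f') (c * b + g') =
      c * (c * pb a b + pb a g' + pb f' b) + pb f' g' := by
    simp only [pb, map_add, Derivation.leibniz, smul_eq_mul, d0, d1, d2]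
    ring
  rw [key, map_add, map_mul, h0, zero_mul, zero_add]

lemma toSphere_rep (s : ℝ) (p : SpherePoly s) : toSphere s (rep s p) = p :=
  (Ideal.Quotient.mk_surjective (I := sphereIdeal s) p).choose_spec

lemma pbS_toSphere (s : ℝ) (f g : MvPolynomial (Fin 3) ℝ) :
    pbS s (toSphere s f) (toSphere s g) = toSphere s (pb f g) :=
  toSphere_pb_congr s (toSphere_rep s _) (toSphere_rep s _)

lemma Polynomial.exists_derivative_eq (p : Polynomial ℝ) :
    ∃ q : Polynomial ℝ, Polynomial.derivative q = p := by
  induction p using Polynomial.induction_on' with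
  | add p q hp hq =>
    obtain ⟨a, rfl⟩ := hp
    obtain ⟨b, rfl⟩ := hq
    exact ⟨a + b, map_add _ _ _⟩
  | monomial n a =>
    refine ⟨Polynomial.monomial (n + 1) (a / (n + 1)), ?_⟩
    have : (n + 1 : ℝ) ≠ 0 := by positivity
    simp [this]

/-- A nonzero ideal of `ℝ[z]` stable under `f ↦ ((s² - z²) f)''` is everything. -/
lemma Polynomial.eq_top_of_stable {s : ℝ} (hs : s ≠ 0) {J : Ideal (Polynomial ℝ)} (hJ : J ≠ ⊥)
    (hstable : ∀ f ∈ J, Polynomial.derivative (Polynomial.derivative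
      ((Polynomial.C (s ^ 2) - Polynomial.X ^ 2) * f)) ∈ J) : J = ⊤ := by
  set w : Polynomial ℝ := Polynomial.C (s ^ 2) - Polynomial.X ^ 2 with hw
  obtain ⟨d, rfl⟩ := (IsPrincipalIdealRing.principal J).principal
  rw [Ideal.submodule_span_eq] at *
  have hd : d ≠ 0 := by rintro rfl; simp at hJ
  have hw0 : w ≠ 0 := fun h => by
    have := congrArg (Polynomial.eval 0) h
    simp [hw, hs] at this
  have h2 : d ∣ Polynomial.derivative (Polynomial.derivative (w * d)) :=
    Ideal.mem_span_singleton.1 (hstable d (Ideal.mem_span_singleton_self d))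
  have h1 : d ∣ Polynomial.derivative (w * d) := by
    have hX := Ideal.mem_span_singleton.1
      (hstable (Polynomial.X * d) (Ideal.mem_span_singleton.2 (dvd_mul_left d _)))
    have e : Polynomial.derivative (Polynomial.derivative (w * (Polynomial.X * d))) =
        Polynomial.C 2 * Polynomial.derivative (w * d)
          + Polynomial.X * Polynomial.derivative (Polynomial.derivative (w * d)) := by
      rw [mul_left_comm]
      simp only [Polynomial.derivative_mul, Polynomial.derivative_X, Polynomial.derivative_add,
        Polynomial.derivative_one, map_ofNat]
      ring
    rw [e, dvd_add_left (h2.mul_left _)] at hX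
    exact (isUnit_iff_ne_zero.2 two_ne_zero |>.map Polynomial.C).dvd_mul_left.1 hX
  rw [Ideal.span_singleton_eq_top]
  by_contra hu
  set D := d.map (algebraMap ℝ ℂ) with hD
  set W := w.map (algebraMap ℝ ℂ) with hW
  have hdeg : D.degree ≠ 0 := by
    rwa [Polynomial.degree_map, Ne, ← Polynomial.isUnit_iff_degree_eq_zero]
  obtain ⟨a, ha⟩ := IsAlgClosed.exists_root D hdeg
  have h1' : D ∣ Polynomial.derivative (W * D) := by
    simpa [hD, hW, Polynomial.derivative_map] using Polynomial.map_dvd (algebraMap ℝ ℂ) h1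
  have h2' : D ∣ Polynomial.derivative (Polynomial.derivative (W * D)) := by
    simpa [hD, hW, Polynomial.derivative_map] using Polynomial.map_dvd (algebraMap ℝ ℂ) h2
  have hD0 : D ≠ 0 := Polynomial.map_ne_zero hd
  have hW0 : W ≠ 0 := Polynomial.map_ne_zero hw0
  have hne : ∀ q : Polynomial ℂ, q ≠ 0 → q.IsRoot a → Polynomial.derivative q ≠ 0 := by
    intro q hq hr h
    rw [Polynomial.eq_C_of_derivative_eq_zero h] at hq hr
    simp_all
  have r0 : (W * D).IsRoot a := ha.dvd (dvd_mul_left _ _)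
  have r1 := ha.dvd h1'
  have n1 := hne _ (mul_ne_zero hW0 hD0) r0
  have m1 := Polynomial.rootMultiplicity_le_rootMultiplicity_of_dvd (hne _ n1 r1) h2' a
  rw [Polynomial.derivative_rootMultiplicity_of_root r1,
    Polynomial.derivative_rootMultiplicity_of_root r0,
    Polynomial.rootMultiplicity_mul (mul_ne_zero hW0 hD0)] at m1
  have hk := (Polynomial.rootMultiplicity_pos hD0).2 ha
  obtain ⟨hWa, hWa'⟩ := (Polynomial.one_lt_rootMultiplicity_iff_isRoot hW0).1
    (show 1 < W.rootMultiplicity a by omega)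
  have ha0 : a = 0 := by simpa [hW, hw, Polynomial.derivative_pow] using hWa'
  simp [hW, hw, ha0, hs] at hWa

/-- **Groenewold–Van Hove no-go theorem for `S²`** (Theorem 2.2):
every admissible quantization of `(P, P¹)` is trivial. -/
theorem noGo_sphere (s : ℝ) (hs : 0 < s)
    (V : Type) [NormedAddCommGroup V] [InnerProductSpace ℂ V]
    [FiniteDimensional ℂ V] [Nontrivial V]
    (Q : SpherePoly s →ₗ[ℝ] Module.End ℂ V)
    (hselfadj : ∀ f : SpherePoly s, (Q f).IsSymmetric)
    (hbracket : ∀ f g : SpherePoly s,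
      Q (pbS s f g) = -Complex.I • (Q f * Q g - Q g * Q f))
    (hone : Q 1 = 1)
    (hirred : ∀ W : Submodule ℂ V,
      (∀ i : Fin 3, ∀ v ∈ W, Q (S s i) v ∈ W) → W = ⊥ ∨ W = ⊤) :
    ∀ i : Fin 3, Q (S s i) = 0 := by
  set K : Submodule ℝ (MvPolynomial (Fin 3) ℝ) :=
    LinearMap.ker (Q ∘ₗ (Ideal.Quotient.mkₐ ℝ (sphereIdeal s)).toLinearMap) with hK
  have memK : ∀ f, f ∈ K ↔ Q (toSphere s f) = 0 := fun f => Iff.rfl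
  have hKpb : ∀ f ∈ K, ∀ g, pb f g ∈ K := fun f hf g => by
    rw [memK] at hf ⊢
    rw [← pbS_toSphere, hbracket, hf]
    simp
  have hKcongr : ∀ f g, f ∈ K → toSphere s f = toSphere s g → g ∈ K := fun f g hf h => by
    rw [memK] at hf ⊢
    rwa [← h]
  set E := Polynomial.aeval (R := ℝ) (X 2 : MvPolynomial (Fin 3) ℝ) with hE
  have hsmul : ∀ h f : Polynomial ℝ, (E f * X 0 ∈ K ∧ E f * X 1 ∈ K) →
      (E (h * f) * X 0 ∈ K ∧ E (h * f) * X 1 ∈ K) := by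
    rintro h f ⟨h0, h1⟩
    obtain ⟨g, rfl⟩ := Polynomial.exists_derivative_eq h
    constructor
    · convert hKpb _ h1 (E g) using 1
      simp [pb, hE, pderiv_X]
      ring
    · convert K.neg_mem (hKpb _ h0 (E g)) using 1
      simp [pb, hE, pderiv_X]
      ring
  let J : Ideal (Polynomial ℝ) :=
    { carrier := {f | E f * X 0 ∈ K ∧ E f * X 1 ∈ K}
      zero_mem' := by simp
      add_mem' := fun {a b} ha hb => by
        simp only [Set.mem_ofPred_eq, map_add, add_mul] at *
        exact ⟨K.add_mem ha.1 hb.1, K.add_mem ha.2 hb.2⟩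
      smul_mem' := hsmul }
  have hderiv : ∀ p : Polynomial ℝ, E p ∈ K → Polynomial.derivative p ∈ J := by
    intro p hp
    constructor
    · convert K.neg_mem (hKpb _ hp (X 1)) using 1
      simp [pb, hE, pderiv_X, mul_comm]
    · convert hKpb _ hp (X 0) using 1
      simp [pb, hE, pderiv_X, mul_comm]
  have hJ : J ≠ ⊥ := by
    intro hbot
    set T : Polynomial ℝ →ₗ[ℝ] Module.End ℂ V :=
      Q ∘ₗ (Ideal.Quotient.mkₐ ℝ (sphereIdeal s)).toLinearMap ∘ₗ E.toLinearMap with hT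
    have hinj : Function.Injective T := by
      rw [← LinearMap.ker_eq_bot, LinearMap.ker_eq_bot']
      intro p hp
      have hp' : Polynomial.derivative p = 0 := by
        have := hderiv p hp
        rwa [hbot] at this
      rw [Polynomial.eq_C_of_derivative_eq_zero hp'] at hp ⊢
      have : T (Polynomial.C (p.coeff 0)) = p.coeff 0 • (1 : Module.End ℂ V) := by
        rw [← hone, ← map_smul, ← Polynomial.algebraMap_eq, Algebra.algebraMap_eq_smul_one]
        simp [hT]
      rw [this, smul_eq_zero] at hp
      simp [hp.resolve_right one_ne_zero]
    have : Module.Finite ℝ (Module.End ℂ V) := Module.Finite.trans ℂ _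
    have := Module.Finite.of_injective T hinj
    exact Polynomial.not_finite this
  have hstable : ∀ f ∈ J, Polynomial.derivative (Polynomial.derivative
      ((Polynomial.C (s ^ 2) - Polynomial.X ^ 2) * f)) ∈ J := by
    rintro f ⟨h0, h1⟩
    refine hderiv _ (hKcongr _ _ (K.sub_mem (hKpb _ h1 (X 0)) (hKpb _ h0 (X 1))) ?_)
    have hrel : toSphere s (X 0 ^ 2 + X 1 ^ 2 + X 2 ^ 2 - C (s ^ 2)) = 0 :=
      Ideal.Quotient.eq_zero_iff_mem.2 (Ideal.subset_span rfl)
    rw [← sub_eq_zero, ← map_sub]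
    have e : pb (E f * X 1) (X 0) - pb (E f * X 0) (X 1) -
        E (Polynomial.derivative ((Polynomial.C (s ^ 2) - Polynomial.X ^ 2) * f)) =
        E (Polynomial.derivative f) * (X 0 ^ 2 + X 1 ^ 2 + X 2 ^ 2 - C (s ^ 2)) := by
      have hC : (C 2 : MvPolynomial (Fin 3) ℝ) = 2 := map_ofNat C 2
      simp [pb, hE, pderiv_X, MvPolynomial.algebraMap_eq, Polynomial.derivative_pow, hC]
      ring
    rw [e, map_mul, hrel, mul_zero]
  have h1J : (1 : Polynomial ℝ) ∈ J := by
    rw [Polynomial.eq_top_of_stable hs.ne' hJ hstable]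
    trivial
  obtain ⟨h0, h1⟩ : E 1 * X 0 ∈ K ∧ E 1 * X 1 ∈ K := h1J
  rw [map_one, one_mul] at h0 h1
  have h2 : (X 2 : MvPolynomial (Fin 3) ℝ) ∈ K := by
    convert hKpb _ h0 (X 1) using 1
    simp [pb, pderiv_X]
  intro i
  fin_cases i
  exacts [h0, h1, h2]

end
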